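/- arXiv:2605.27623 — 2 statements merged into one kernel-verified Lean document; each statement's English description precedes it below -/
import Mathlib

section
/- Let d ≥ 3 be an integer. For a general pencil of plane curves of degree d over ℂ and any base point p of the pencil (a common zero of the two spanning forms), the number of members C of the pencil such that C is smooth at p and the tangent line to C at p has contact order at least 3 with C at p (i.e., C has a flex at p) is exactly 3. -/
noncomputable section

/-- The restriction of the form `F` to the line through `[v]` and `[w]`,
parametrized by `t ↦ v + t • w`, as a polynomial in `t`. -/
def linePoly (F : MvPolynomial (Fin 3) ℂ) (v w : Fin 3 → ℂ) : Polynomial ℂ :=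
  MvPolynomial.aeval (fun i => Polynomial.C (v i) + Polynomial.X * Polynomial.C (w i)) F

/-- The line through the two (projectively distinct) points `[v]`, `[w]` has contact
order at least `m` with the curve `{F = 0}` at the point `[v]`. -/
def ContactLE (F : MvPolynomial (Fin 3) ℂ) (v w : Fin 3 → ℂ) (m : ℕ) : Prop :=
  (Polynomial.X : Polynomial ℂ) ^ m ∣ linePoly F v w

/-- The member of the pencil spanned by `F` and `G` corresponding to `c ∈ ℙ¹`. -/
def pencilMember (F G : MvPolynomial (Fin 3) ℂ) (c : Projectivization ℂ (Fin 2 → ℂ)) :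
    MvPolynomial (Fin 3) ℂ :=
  c.rep 0 • F + c.rep 1 • G

/-- The coefficient vector of a pair of forms. -/
def coeffs2 (F G : MvPolynomial (Fin 3) ℂ) : (Fin 3 →₀ ℕ) ⊕ (Fin 3 →₀ ℕ) → ℂ :=
  Sum.elim (fun m => MvPolynomial.coeff m F) (fun m => MvPolynomial.coeff m G)

/-- The set of members `C` of the pencil spanned by `F` and `G` that are smooth at the
point `[v]` and have a flex at `[v]`: the tangent line to `C` at `[v]` (spanned by `v`
and any vector `w`, independent from `v`, annihilated by the gradient of `C` at `v`)
has contact order at least 3 with `C` at `[v]`. -/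
def membersWithFlexAt (F G : MvPolynomial (Fin 3) ℂ) (v : Fin 3 → ℂ) :
    Set (Projectivization ℂ (Fin 2 → ℂ)) :=
  {c | (∃ i : Fin 3, MvPolynomial.eval v (MvPolynomial.pderiv i (pencilMember F G c)) ≠ 0) ∧
    ∃ w : Fin 3 → ℂ, LinearIndependent ℂ ![v, w] ∧
      (∑ i, MvPolynomial.eval v (MvPolynomial.pderiv i (pencilMember F G c)) * w i) = 0 ∧
      ContactLE (pencilMember F G c) v w 3}

open MvPolynomial in
lemma fx_pderiv_comm {R : Type*} [CommRing R] (i j : Fin 3) (F : MvPolynomial (Fin 3) R) :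
    pderiv i (pderiv j F) = pderiv j (pderiv i F) := by
  have h : ⁅(pderiv i : Derivation R (MvPolynomial (Fin 3) R) (MvPolynomial (Fin 3) R)),
      (pderiv j : Derivation R (MvPolynomial (Fin 3) R) (MvPolynomial (Fin 3) R))⁆ = 0 := by
    apply MvPolynomial.derivation_ext (R := R)
    intro k
    rw [Derivation.commutator_apply]
    simp only [pderiv_X, Pi.single_apply]
    split_ifs <;> simp
  have h2 := congrArg (fun D => D F) h
  simp only [Derivation.commutator_apply] at h2
  exact sub_eq_zero.mp h2

lemma fx_sum3 {M : Type*} [AddCommMonoid M] (k : Fin 3) (f : Fin 3 → M) :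
    ∑ i, f i = f k + f (k + 1) + f (k + 2) := by
  fin_cases k
  · simp [Fin.sum_univ_three]
  · simp only [Fin.sum_univ_three]
    change _ = f 1 + f 2 + f 0
    abel
  · simp only [Fin.sum_univ_three]
    change _ = f 2 + f 0 + f 1
    abel

open MvPolynomial in
lemma fx_linePoly_coeff_zero (F : MvPolynomial (Fin 3) ℂ) (v w : Fin 3 → ℂ) :
    (linePoly F v w).coeff 0 = eval v F := by
  rw [Polynomial.coeff_zero_eq_eval_zero, linePoly]
  have hg : ∀ i, Polynomial.eval 0
      ((fun i => Polynomial.C (v i) + Polynomial.X * Polynomial.C (w i)) i) = v i := by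
    simp
  generalize (fun i => Polynomial.C (v i) + Polynomial.X * Polynomial.C (w i)) = g at *
  induction F using MvPolynomial.induction_on with
  | C a => simp
  | add p q hp hq => simp [hp, hq]
  | mul_X p i hp => simp [hp, hg]

open MvPolynomial in
lemma fx_aeval_deriv (F : MvPolynomial (Fin 3) ℂ) (g : Fin 3 → Polynomial ℂ) :
    Polynomial.derivative (aeval g F) =
      ∑ i, Polynomial.derivative (g i) * aeval g (pderiv i F) := by
  induction F using MvPolynomial.induction_on with
  | C a => simp
  | add p q hp hq => simp [hp, hq, mul_add, Finset.sum_add_distrib]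
  | mul_X p i hp =>
    simp only [map_mul, Polynomial.derivative_mul, hp, Derivation.leibniz, smul_eq_mul, map_add,
      aeval_X, pderiv_X, mul_add, Finset.sum_add_distrib]
    rw [add_comm]
    congr 1
    · rw [Finset.sum_eq_single i]
      · simp; ring
      · intro b _ hb
        simp [hb.symm]
      · simp
    · rw [Finset.sum_mul]
      refine Finset.sum_congr rfl fun j _ => by ring

open MvPolynomial in
lemma fx_linePoly_deriv (F : MvPolynomial (Fin 3) ℂ) (v w : Fin 3 → ℂ) :
    Polynomial.derivative (linePoly F v w) =
      ∑ i, Polynomial.C (w i) * linePoly (pderiv i F) v w := by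
  unfold linePoly
  rw [fx_aeval_deriv]
  refine Finset.sum_congr rfl fun j _ => ?_
  congr 1
  simp

open MvPolynomial in
lemma fx_contact_iff (F : MvPolynomial (Fin 3) ℂ) (v w : Fin 3 → ℂ) :
    ContactLE F v w 3 ↔ eval v F = 0 ∧ (∑ i, eval v (pderiv i F) * w i) = 0 ∧
      (∑ i, ∑ j, eval v (pderiv j (pderiv i F)) * w i * w j) = 0 := by
  have h1 : (linePoly F v w).coeff 1 = ∑ i, eval v (pderiv i F) * w i := by
    have := Polynomial.coeff_derivative (linePoly F v w) 0
    rw [fx_linePoly_deriv] at this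
    simp only [Polynomial.finsetSum_coeff, Polynomial.coeff_C_mul, fx_linePoly_coeff_zero] at this
    simp only [mul_comm (eval v _)]
    simpa using this.symm
  have h2 : (linePoly F v w).coeff 2 * 2 =
      ∑ i, ∑ j, eval v (pderiv j (pderiv i F)) * w i * w j := by
    have e1 := Polynomial.coeff_derivative (linePoly F v w) 1
    have e2 := Polynomial.coeff_derivative (Polynomial.derivative (linePoly F v w)) 0
    rw [fx_linePoly_deriv] at e2
    simp only [Polynomial.derivative_sum, Polynomial.derivative_C_mul, fx_linePoly_deriv,
      Polynomial.finsetSum_coeff, Polynomial.coeff_C_mul, fx_linePoly_coeff_zero] at e2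
    rw [fx_linePoly_deriv, Polynomial.finsetSum_coeff] at e1
    simp only [Polynomial.coeff_C_mul] at e1
    norm_num at e1 e2
    rw [← e1, ← e2]
    refine Finset.sum_congr rfl fun i _ => ?_
    rw [Finset.mul_sum]
    refine Finset.sum_congr rfl fun j _ => by ring
  unfold ContactLE
  rw [Polynomial.X_pow_dvd_iff, ← h1, ← h2, ← fx_linePoly_coeff_zero F v w]
  constructor
  · intro h
    exact ⟨h 0 (by norm_num), h 1 (by norm_num), by rw [h 2 (by norm_num)]; simp⟩
  · rintro ⟨a, b, c⟩ n hn
    interval_cases n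
    · exact a
    · exact b
    · simpa using c

open MvPolynomial in
lemma fx_euler {F : MvPolynomial (Fin 3) ℂ} {n : ℕ} (hF : F.IsHomogeneous n) (v : Fin 3 → ℂ)
    (k : Fin 3) : v k * eval v (pderiv k F) + v (k + 1) * eval v (pderiv (k + 1) F)
      + v (k + 2) * eval v (pderiv (k + 2) F) = n * eval v F := by
  have := congrArg (eval v) hF.sum_X_mul_pderiv
  rw [fx_sum3 k] at this
  simpa using this

/-- Flex criterion in the affine chart `v k = 1`. -/
lemma fx_flex_alg (a b x y : ℂ) (e h0 h1 h2 h00 h01 h02 h11 h12 h22 w0 w1 w2 : ℂ)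
    (E : h0 + a * h1 + b * h2 = 0) (E0 : h00 + a * h01 + b * h02 = e * h0)
    (E1 : h01 + a * h11 + b * h12 = e * h1) (E2 : h02 + a * h12 + b * h22 = e * h2)
    (hw : h0 * w0 + h1 * w1 + h2 * w2 = 0) (hx : x = w1 - w0 * a) (hy : y = w2 - w0 * b) :
    h1 * x + h2 * y = 0 ∧ h11 * x ^ 2 + 2 * h12 * x * y + h22 * y ^ 2 =
    h00 * w0 ^ 2 + h11 * w1 ^ 2 + h22 * w2 ^ 2 + 2 * h01 * w0 * w1 + 2 * h02 * w0 * w2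
      + 2 * h12 * w1 * w2 := by
  subst hx hy
  constructor
  · linear_combination hw - w0 * E
  · linear_combination (-2) * w0 * e * hw  + w0 ^ 2 * e * E + (w0^2 * (-1)) * E0 + (w0^2 * a - 2 * w0 * w1) * E1 + (w0^2 * b - 2 * w0 * w2) * E2

open MvPolynomial in
lemma fx_flex_iff {H : MvPolynomial (Fin 3) ℂ} {d : ℕ} (hH : H.IsHomogeneous d)
    (v : Fin 3 → ℂ) (k : Fin 3) (hv : v k = 1) (h0 : eval v H = 0)
    (hs : eval v (pderiv (k + 1) H) ≠ 0 ∨ eval v (pderiv (k + 2) H) ≠ 0) :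
    ((∃ i : Fin 3, eval v (pderiv i H) ≠ 0) ∧
    ∃ w : Fin 3 → ℂ, LinearIndependent ℂ ![v, w] ∧
      (∑ i, eval v (pderiv i H) * w i) = 0 ∧ ContactLE H v w 3) ↔
    eval v (pderiv (k + 1) (pderiv (k + 1) H)) * eval v (pderiv (k + 2) H) ^ 2
      - 2 * eval v (pderiv (k + 1) (pderiv (k + 2) H)) * eval v (pderiv (k + 1) H)
          * eval v (pderiv (k + 2) H)
      + eval v (pderiv (k + 2) (pderiv (k + 2) H)) * eval v (pderiv (k + 1) H) ^ 2 = 0 := by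
  have E := fx_euler hH v k
  have E' := fun i => fx_euler (hH.pderiv (i := i)) v k
  have E0 := E' k
  have E1 := E' (k + 1)
  have E2 := E' (k + 2)
  simp only [fx_contact_iff, fx_sum3 k]
  rw [fx_pderiv_comm (k + 1) k] at E0
  rw [fx_pderiv_comm (k + 2) k] at E0
  rw [fx_pderiv_comm (k + 2) (k + 1)] at E1
  rw [fx_pderiv_comm (k + 1) k, fx_pderiv_comm (k + 2) k, fx_pderiv_comm (k + 2) (k + 1)]
  rw [h0, hv] at E
  rw [hv] at E0 E1 E2
  have hne1 : k + 1 ≠ k := by fin_cases k <;> decide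
  have hne2 : k + 2 ≠ k := by fin_cases k <;> decide
  have hne3 : k + 2 ≠ k + 1 := by fin_cases k <;> decide
  generalize eval v (pderiv k (pderiv k H)) = h00 at *
  generalize eval v (pderiv k (pderiv (k + 1) H)) = h01 at *
  generalize eval v (pderiv k (pderiv (k + 2) H)) = h02 at *
  generalize eval v (pderiv (k + 1) (pderiv (k + 1) H)) = h11 at *
  generalize eval v (pderiv (k + 1) (pderiv (k + 2) H)) = h12 at *
  generalize eval v (pderiv (k + 2) (pderiv (k + 2) H)) = h22 at *
  have hex : (∃ i : Fin 3, eval v (pderiv i H) ≠ 0) := by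
    rcases hs with h | h <;> exact ⟨_, h⟩
  generalize eval v (pderiv k H) = g0 at *
  generalize eval v (pderiv (k + 1) H) = g1 at *
  generalize eval v (pderiv (k + 2) H) = g2 at *
  constructor
  · rintro ⟨-, w, hli, hw, -, -, hq⟩
    obtain ⟨A, B⟩ := fx_flex_alg (v (k + 1)) (v (k + 2)) _ _ ((d - 1 : ℕ) : ℂ) g0 g1 g2 h00 h01 h02
      h11 h12 h22 (w k) (w (k + 1)) (w (k + 2)) (by linear_combination E) (by linear_combination E0)
      (by linear_combination E1) (by linear_combination E2) hw rfl rfl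
    have hxy : ¬ (w (k + 1) - w k * v (k + 1) = 0 ∧ w (k + 2) - w k * v (k + 2) = 0) := by
      rintro ⟨hx, hy⟩
      rw [LinearIndependent.pair_iff] at hli
      have := hli (w k) (-1) (by
        ext i
        have hi : i = k ∨ i = k + 1 ∨ i = k + 2 := by
          clear * -; revert i k; decide
        rcases hi with rfl | rfl | rfl
        · simp [hv]
        · simp; linear_combination -hx
        · simp; linear_combination -hy)
      simp at this
    generalize w (k + 1) - w k * v (k + 1) = x at *
    generalize w (k + 2) - w k * v (k + 2) = y at *
    have hB : h11 * x ^ 2 + 2 * h12 * x * y + h22 * y ^ 2 = 0 := by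
      rw [B]; linear_combination hq
    by_cases hx : x = 0
    · have hy : y ≠ 0 := fun h => hxy ⟨hx, h⟩
      subst hx
      have hg2 : g2 = 0 := by simpa [hy] using A
      have : h22 = 0 := by simpa [hy] using hB
      rw [hg2, this]; ring
    · have : x ^ 2 * (h11 * g2 ^ 2 - 2 * h12 * g1 * g2 + h22 * g1 ^ 2) = 0 := by
        linear_combination g2 ^ 2 * hB + (-2 * h12 * x * g2 + h22 * (g1 * x - g2 * y)) * A
      rcases mul_eq_zero.mp this with h | h
      · exact absurd (pow_eq_zero_iff (by norm_num) |>.mp h) hx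
      · exact h
  · intro hc
    refine ⟨hex, fun i => if i = k + 1 then -g2 else if i = k + 2 then g1 else 0, ?_, ?_, h0, ?_, ?_⟩
    · rw [LinearIndependent.pair_iff]
      intro s t hst
      have c0 := congrFun hst k
      have c1 := congrFun hst (k + 1)
      have c2 := congrFun hst (k + 2)
      simp [hne1.symm, hne2.symm, hv] at c0
      subst c0
      simp at c1
      simp [hne3] at c2
      refine ⟨rfl, ?_⟩
      rcases hs with h | h
      · exact c2.resolve_right h
      · exact c1.resolve_right h
    · simp [hne1.symm, hne2.symm, hne3]; ring
    · simp [hne1.symm, hne2.symm, hne3]; ring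
    · simp [hne1.symm, hne2.symm, hne3]; linear_combination hc

open MvPolynomial in
/-- The binary cubic (dehomogenized) whose roots are the members of the pencil with a flex. -/
def fxCubic {R : Type*} [CommRing R] (F G : MvPolynomial (Fin 3) R) (v : Fin 3 → R) (k : Fin 3) :
    Cubic R :=
  let f1 := eval v (pderiv (k + 1) F)
  let f2 := eval v (pderiv (k + 2) F)
  let g1 := eval v (pderiv (k + 1) G)
  let g2 := eval v (pderiv (k + 2) G)
  let f11 := eval v (pderiv (k + 1) (pderiv (k + 1) F))
  let f12 := eval v (pderiv (k + 1) (pderiv (k + 2) F))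
  let f22 := eval v (pderiv (k + 2) (pderiv (k + 2) F))
  let g11 := eval v (pderiv (k + 1) (pderiv (k + 1) G))
  let g12 := eval v (pderiv (k + 1) (pderiv (k + 2) G))
  let g22 := eval v (pderiv (k + 2) (pderiv (k + 2) G))
  { a := f11 * f2 ^ 2 - 2 * f12 * f1 * f2 + f22 * f1 ^ 2
    b := g11 * f2 ^ 2 + 2 * f11 * f2 * g2 - 2 * (g12 * f1 * f2 + f12 * (f1 * g2 + f2 * g1))
          + g22 * f1 ^ 2 + 2 * f22 * f1 * g1
    c := f11 * g2 ^ 2 + 2 * g11 * g2 * f2 - 2 * (f12 * g1 * g2 + g12 * (g1 * f2 + g2 * f1))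
          + f22 * g1 ^ 2 + 2 * g22 * g1 * f1
    d := g11 * g2 ^ 2 - 2 * g12 * g1 * g2 + g22 * g1 ^ 2 }

open MvPolynomial in
/-- The Jacobian of the pencil in the chart. -/
def fxJac {R : Type*} [CommRing R] (F G : MvPolynomial (Fin 3) R) (v : Fin 3 → R) (k : Fin 3) : R :=
  eval v (pderiv (k + 1) F) * eval v (pderiv (k + 2) G)
    - eval v (pderiv (k + 2) F) * eval v (pderiv (k + 1) G)

/-- The polynomial whose nonvanishing guarantees exactly three flexes. -/
def fxD {R : Type*} [CommRing R] (F G : MvPolynomial (Fin 3) R) (v : Fin 3 → R) (k : Fin 3) : R :=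
  fxJac F G v k * (fxCubic F G v k).a * (fxCubic F G v k).discr

open MvPolynomial in
lemma fxD_map {R S : Type*} [CommRing R] [CommRing S] (φ : R →+* S) (F G : MvPolynomial (Fin 3) R)
    (v : Fin 3 → R) (k : Fin 3) :
    φ (fxD F G v k) = fxD (map φ F) (map φ G) (fun i => φ (v i)) k := by
  have key : ∀ H : MvPolynomial (Fin 3) R, eval (fun i => φ (v i)) (map φ H) = φ (eval v H) := by
    intro H
    rw [eval_map, eval, coe_eval₂Hom]
    exact (eval₂_comp_left φ (RingHom.id R) v H).symm
  simp only [fxD, fxJac, fxCubic, Cubic.discr, pderiv_map, key]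
  simp only [map_mul, map_sub, map_add, map_pow, map_ofNat]

open MvPolynomial in
lemma fx_count {d : ℕ} {F G : MvPolynomial (Fin 3) ℂ} (hF : F.IsHomogeneous d)
    (hG : G.IsHomogeneous d) (v : Fin 3 → ℂ) (k : Fin 3) (hv : v k = 1)
    (hFv : eval v F = 0) (hGv : eval v G = 0) (hD : fxD F G v k ≠ 0) :
    (membersWithFlexAt F G v).Finite ∧ (membersWithFlexAt F G v).ncard = 3 := by
  classical
  have hJ : fxJac F G v k ≠ 0 := fun h => hD (by simp [fxD, h])
  have ha : (fxCubic F G v k).a ≠ 0 := fun h => hD (by simp [fxD, h])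
  have hdisc : (fxCubic F G v k).discr ≠ 0 := fun h => hD (by simp [fxD, h])
  have hmem : ∀ c : Projectivization ℂ (Fin 2 → ℂ), c ∈ membersWithFlexAt F G v ↔
      (fxCubic F G v k).a * c.rep 0 ^ 3 + (fxCubic F G v k).b * c.rep 0 ^ 2 * c.rep 1
        + (fxCubic F G v k).c * c.rep 0 * c.rep 1 ^ 2 + (fxCubic F G v k).d * c.rep 1 ^ 3 = 0 := by
    intro c
    have hne : ¬ (c.rep 0 = 0 ∧ c.rep 1 = 0) := by
      rintro ⟨h0, h1⟩
      apply c.rep_nonzero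
      ext i
      fin_cases i
      · exact h0
      · exact h1
    have hH : (pencilMember F G c).IsHomogeneous d := by
      unfold pencilMember
      rw [MvPolynomial.smul_eq_C_mul, MvPolynomial.smul_eq_C_mul]
      exact (hF.C_mul _).add (hG.C_mul _)
    have hH0 : eval v (pencilMember F G c) = 0 := by simp [pencilMember, hFv, hGv]
    unfold membersWithFlexAt
    rw [Set.mem_ofPred_eq, fx_flex_iff hH v k hv hH0]
    · simp only [pencilMember, fxCubic, map_add, Derivation.map_smul, smul_eval]
      refine Eq.congr ?_ rfl
      ring
    · by_contra hcon
      push Not at hcon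
      obtain ⟨h1, h2⟩ := hcon
      simp only [pencilMember, map_add, Derivation.map_smul, smul_eval] at h1 h2
      unfold fxJac at hJ
      apply hne
      constructor
      · apply (mul_eq_zero.mp _).resolve_right hJ
        linear_combination (eval v (pderiv (k + 2) G)) * h1 - (eval v (pderiv (k + 1) G)) * h2
      · apply (mul_eq_zero.mp _).resolve_right hJ
        linear_combination (eval v (pderiv (k + 1) F)) * h2 - (eval v (pderiv (k + 2) F)) * h1
  generalize fxCubic F G v k = P at *
  have hcard := Cubic.card_roots_of_discr_ne_zero (φ := RingHom.id ℂ) ha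
    (IsAlgClosed.splits _) hdisc
  have hP : (Cubic.map (RingHom.id ℂ) P) = P := rfl
  rw [hP] at hcard
  have hnz : ∀ t : ℂ, (![t, 1] : Fin 2 → ℂ) ≠ 0 := fun t h => by simpa using congrFun h 1
  let f : ℂ → Projectivization ℂ (Fin 2 → ℂ) := fun t => Projectivization.mk ℂ ![t, 1] (hnz t)
  have hf : Function.Injective f := by
    intro s t hst
    obtain ⟨a, ha⟩ := (Projectivization.mk_eq_mk_iff' ℂ _ _ _ _).mp hst
    have h0 := congrFun ha 0
    have h1 := congrFun ha 1
    simp at h0 h1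
    rw [← h0, h1, one_mul]
  have hset : membersWithFlexAt F G v = Set.image f (P.roots.toFinset : Set ℂ) := by
    ext c
    rw [hmem]
    simp only [Set.mem_image, Finset.mem_coe, Multiset.mem_toFinset,
      Cubic.mem_roots_iff (Cubic.ne_zero_of_a_ne_zero ha)]
    constructor
    · intro h
      have h1 : c.rep 1 ≠ 0 := by
        intro h1
        have h0 : c.rep 0 = 0 := by
          rw [h1] at h
          simpa [ha] using h
        apply c.rep_nonzero
        ext i
        fin_cases i
        · exact h0
        · exact h1
      refine ⟨c.rep 0 / c.rep 1, ?_, ?_⟩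
      · field_simp
        linear_combination h
      · conv_rhs => rw [← c.mk_rep]
        rw [Projectivization.mk_eq_mk_iff']
        refine ⟨(c.rep 1)⁻¹, ?_⟩
        ext i
        fin_cases i
        · simp; field_simp
        · simp [h1]
    · rintro ⟨t, ht, rfl⟩
      obtain ⟨a, ha⟩ := Projectivization.exists_smul_eq_mk_rep ℂ ![t, 1] (hnz t)
      have h0 : (f t).rep 0 = a * t := by
        rw [← ha]; simp [Units.smul_def]
      have h1 : (f t).rep 1 = a := by
        rw [← ha]; simp [Units.smul_def]
      rw [h0, h1]
      linear_combination (a : ℂ) ^ 3 * ht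
  rw [hset]
  refine ⟨(Finset.finite_toSet _).image _, ?_⟩
  rw [Set.ncard_image_of_injective _ hf, Set.ncard_coe_finset, hcard]

open MvPolynomial in
lemma fx_eval_smul {F : MvPolynomial (Fin 3) ℂ} {n : ℕ} (hF : F.IsHomogeneous n) {S : Type*}
    [CommRing S] [Algebra ℂ S] (r : S) (v : Fin 3 → S) :
    aeval (fun i => r * v i) F = r ^ n * aeval v F := by
  rw [aeval_def, aeval_def, eval₂_eq, eval₂_eq, Finset.mul_sum]
  refine Finset.sum_congr rfl fun m hm => ?_
  have : ∏ i ∈ m.support, (r * v i) ^ m i = r ^ n * ∏ i ∈ m.support, v i ^ m i := by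
    simp only [mul_pow, Finset.prod_mul_distrib, Finset.prod_pow_eq_pow_sum]
    congr 2
    exact (hF.degree_eq_sum_deg_support hm).symm
  rw [this]; ring

open MvPolynomial in
lemma fx_members_smul_sub {d : ℕ} {F G : MvPolynomial (Fin 3) ℂ} (hF : F.IsHomogeneous d)
    (hG : G.IsHomogeneous d) (v : Fin 3 → ℂ) (r : ℂ) (hr : r ≠ 0) :
    membersWithFlexAt F G v ⊆ membersWithFlexAt F G (fun i => r * v i) := by
  rintro c ⟨⟨i, hi⟩, w, hli, hw, hc⟩
  have hH : (pencilMember F G c).IsHomogeneous d := by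
    unfold pencilMember
    rw [MvPolynomial.smul_eq_C_mul, MvPolynomial.smul_eq_C_mul]
    exact (hF.C_mul _).add (hG.C_mul _)
  generalize hHe : pencilMember F G c = H at *
  have key : ∀ i, eval (fun i => r * v i) (pderiv i H) = r ^ (d - 1) * eval v (pderiv i H) := by
    intro i
    have := fx_eval_smul (hH.pderiv (i := i)) r v
    simpa [aeval_eq_eval] using this
  refine ⟨⟨i, ?_⟩, fun i => r * w i, ?_, ?_, ?_⟩
  · rw [hHe, key]; exact mul_ne_zero (pow_ne_zero _ hr) hi
  · rw [LinearIndependent.pair_iff] at hli ⊢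
    intro s t hst
    refine hli s t ?_
    ext j
    have := congrFun hst j
    simp at this ⊢
    apply mul_left_cancel₀ hr
    linear_combination this
  · rw [hHe]
    simp only [key]
    have : ∑ i, r ^ (d - 1) * eval v (pderiv i H) * (r * w i)
        = r ^ (d - 1) * r * ∑ i, eval v (pderiv i H) * w i := by
      rw [Finset.mul_sum]
      exact Finset.sum_congr rfl fun j _ => by ring
    rw [this, hw, mul_zero]
  · rw [hHe]
    unfold ContactLE linePoly at *
    have := fx_eval_smul hH (Polynomial.C r)
      (fun i => Polynomial.C (v i) + Polynomial.X * Polynomial.C (w i))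
    have e : (fun i => Polynomial.C (r * v i) + Polynomial.X * Polynomial.C (r * w i)) =
      (fun i => Polynomial.C r * (Polynomial.C (v i) + Polynomial.X * Polynomial.C (w i))) := by
      ext1 i
      simp only [Polynomial.C_mul]; ring
    rw [e, this]
    exact hc.mul_left _

lemma fx_members_smul {d : ℕ} {F G : MvPolynomial (Fin 3) ℂ} (hF : F.IsHomogeneous d)
    (hG : G.IsHomogeneous d) (v : Fin 3 → ℂ) (r : ℂ) (hr : r ≠ 0) :
    membersWithFlexAt F G (fun i => r * v i) = membersWithFlexAt F G v := by
  apply subset_antisymm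
  · have := fx_members_smul_sub hF hG (fun i => r * v i) r⁻¹ (inv_ne_zero hr)
    simpa [← mul_assoc, inv_mul_cancel₀ hr] using this
  · exact fx_members_smul_sub hF hG v r hr

open MvPolynomial in
lemma fx_elim {σ : Type} [Finite σ] (g : σ → MvPolynomial σ ℂ) (D : MvPolynomial σ ℂ)
    (hD : D ≠ 0) : ∃ Q : MvPolynomial σ ℂ, Q ≠ 0 ∧ D ∣ aeval g Q := by
  classical
  have := Fintype.ofFinite σ
  have hdep : ¬ AlgebraicIndependent ℂ (fun o : Option σ => o.elim D g) := by
    intro h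
    have h1 := h.lift_cardinalMk_le_trdeg
    rw [MvPolynomial.trdeg_of_isDomain] at h1
    simp at h1
  rw [algebraicIndependent_iff] at hdep
  push Not at hdep
  obtain ⟨P, hP0, hPne⟩ := hdep
  set p := optionEquivLeft ℂ σ P with hp
  have hpne : p ≠ 0 := by
    rw [hp]; simpa using hPne
  have hkey : ∀ P : MvPolynomial (Option σ) ℂ, Polynomial.eval₂ (aeval g : MvPolynomial σ ℂ →ₐ[ℂ] _).toRingHom D
      (optionEquivLeft ℂ σ P) = aeval (fun o : Option σ => o.elim D g) P := by
    intro P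
    induction P using MvPolynomial.induction_on with
    | C a => rw [optionEquivLeft_C]; simp
    | add p q hp hq => simp only [map_add, Polynomial.eval₂_add, hp, hq]
    | mul_X p i hp =>
      rw [map_mul, Polynomial.eval₂_mul, hp, map_mul]
      congr 1
      cases i with
      | none => rw [optionEquivLeft_X_none]; simp
      | some i => rw [optionEquivLeft_X_some]; simp
  have hroot : Polynomial.eval₂ (aeval g : MvPolynomial σ ℂ →ₐ[ℂ] _).toRingHom D p = 0 := by
    rw [hp, hkey, hP0]
  clear_value p
  clear hp
  obtain ⟨q, hq, hnd⟩ := Polynomial.exists_eq_pow_rootMultiplicity_mul_and_not_dvd p hpne 0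
  rw [hq, Polynomial.eval₂_mul, Polynomial.eval₂_pow] at hroot
  have hq0 : Polynomial.eval₂ (aeval g : MvPolynomial σ ℂ →ₐ[ℂ] _).toRingHom D q = 0 := by
    refine (mul_eq_zero.mp hroot).resolve_left (pow_ne_zero _ ?_)
    simpa using hD
  refine ⟨q.coeff 0, ?_, ?_⟩
  · intro h
    apply hnd
    simpa using Polynomial.X_dvd_iff.mpr h
  · rw [← Polynomial.divX_mul_X_add q] at hq0
    simp only [Polynomial.eval₂_add, Polynomial.eval₂_mul, Polynomial.eval₂_X,
      Polynomial.eval₂_C] at hq0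
    have : aeval g (q.coeff 0) = -(Polynomial.eval₂ (aeval g : MvPolynomial σ ℂ →ₐ[ℂ] _).toRingHom D q.divX * D) := by
      have h2 : aeval g (q.coeff 0) =
        (aeval g : MvPolynomial σ ℂ →ₐ[ℂ] _).toRingHom (q.coeff 0) := rfl
      rw [h2]
      exact eq_neg_of_add_eq_zero_right hq0
    rw [this]
    exact (Dvd.intro_left _ rfl).neg_right

/-- Monomials of degree `d` in three variables. -/
abbrev FxMon (d : ℕ) : Type := {m : Fin 3 →₀ ℕ // m.degree = d}

instance fxMon_finite (d : ℕ) : Finite (FxMon d) := by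
  classical
  refine Finite.of_injective (β := {m // m ∈ Finset.finsuppAntidiag (Finset.univ : Finset (Fin 3)) d})
    (fun m => ⟨m.1, ?_⟩) ?_
  · rw [Finset.mem_finsuppAntidiag]
    refine ⟨?_, Finset.subset_univ _⟩
    exact (Finsupp.degree_eq_sum m.1).symm.trans m.2
  · intro a b h
    simpa [Subtype.ext_iff] using h

instance fxMon_fintype (d : ℕ) : Fintype (FxMon d) := Fintype.ofFinite _

/-- The monomial `x_k ^ d`. -/
def fxM0 (d : ℕ) (k : Fin 3) : FxMon d := ⟨Finsupp.single k d, by simp⟩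

/-- Coefficient variables for a pair of forms. -/
abbrev FxVar (d : ℕ) : Type := FxMon d ⊕ FxMon d

open MvPolynomial in
/-- Form with given coefficients. -/
def fxForm {R : Type*} [CommRing R] {d : ℕ} (x : FxMon d → R) : MvPolynomial (Fin 3) R :=
  ∑ m, monomial m.1 (x m)

open MvPolynomial in
lemma fxForm_coeff {R : Type*} [CommRing R] {d : ℕ} (x : FxMon d → R) (m : FxMon d) :
    coeff m.1 (fxForm x) = x m := by
  classical
  unfold fxForm
  rw [coeff_sum, Finset.sum_eq_single m]
  · simp
  · intro b _ hb
    rw [coeff_monomial, if_neg]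
    exact fun h => hb (Subtype.ext h)
  · simp

open MvPolynomial in
lemma fxForm_hom {R : Type*} [CommRing R] {d : ℕ} (x : FxMon d → R) :
    (fxForm x).IsHomogeneous d :=
  IsHomogeneous.sum _ _ _ fun m _ => isHomogeneous_monomial _ m.2

open MvPolynomial in
lemma fxForm_eq {R : Type*} [CommRing R] {d : ℕ} {F : MvPolynomial (Fin 3) R}
    (hF : F.IsHomogeneous d) : fxForm (fun m : FxMon d => coeff m.1 F) = F := by
  ext m
  by_cases hm : m.degree = d
  · exact fxForm_coeff _ ⟨m, hm⟩
  · rw [(fxForm_hom _).coeff_eq_zero hm, hF.coeff_eq_zero hm]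

open MvPolynomial in
lemma fxForm_map {R S : Type*} [CommRing R] [CommRing S] (φ : R →+* S) {d : ℕ} (x : FxMon d → R) :
    map φ (fxForm x) = fxForm (fun m => φ (x m)) := by
  simp [fxForm, map_sum, map_monomial]

open MvPolynomial Classical in
/-- The generic point in the chart `k`. -/
def fxV (d : ℕ) (k : Fin 3) : Fin 3 → MvPolynomial (FxVar d) ℂ := fun i =>
  if i = k then 1 else if i = k + 1 then X (Sum.inl (fxM0 d k)) else X (Sum.inr (fxM0 d k))

open MvPolynomial Classical in
/-- Generic form without its `x_k ^ d` term. -/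
def fxPre (d : ℕ) (k : Fin 3) (e : FxMon d → FxVar d) :
    MvPolynomial (Fin 3) (MvPolynomial (FxVar d) ℂ) :=
  fxForm (fun m => if m = fxM0 d k then 0 else X (e m))

open MvPolynomial in
/-- Generic form vanishing at the generic point. -/
def fxGen (d : ℕ) (k : Fin 3) (e : FxMon d → FxVar d) :
    MvPolynomial (Fin 3) (MvPolynomial (FxVar d) ℂ) :=
  fxPre d k e - monomial (fxM0 d k).1 (eval (fxV d k) (fxPre d k e))

open MvPolynomial in
lemma fxGen_map {d : ℕ} {k : Fin 3} {e : FxMon d → FxVar d} {F : MvPolynomial (Fin 3) ℂ}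
    (hF : F.IsHomogeneous d) {v : Fin 3 → ℂ} (hv : v k = 1) (hFv : eval v F = 0)
    (ψ : MvPolynomial (FxVar d) ℂ →+* ℂ) (hψv : ∀ i, ψ (fxV d k i) = v i)
    (hψ : ∀ m, m ≠ fxM0 d k → ψ (X (e m)) = coeff m.1 F) : map ψ (fxGen d k e) = F := by
  classical
  have h1 : map ψ (fxPre d k e) = F - monomial (fxM0 d k).1 (coeff (fxM0 d k).1 F) := by
    unfold fxPre
    rw [fxForm_map, eq_sub_iff_add_eq]
    conv_rhs => rw [← fxForm_eq hF]
    ext m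
    by_cases hm : m.degree = d
    · have a1 := fxForm_coeff (fun m : FxMon d => ψ (if m = fxM0 d k then 0 else X (e m))) ⟨m, hm⟩
      have a2 := fxForm_coeff (fun m : FxMon d => coeff m.1 F) ⟨m, hm⟩
      simp only at a1 a2
      rw [coeff_add, a1, a2, coeff_monomial]
      by_cases h : (⟨m, hm⟩ : FxMon d) = fxM0 d k
      · have h' : (fxM0 d k).1 = m := by rw [← h]
        rw [if_pos h, if_pos h', h']; simp
      · have h' : ¬ (fxM0 d k).1 = m := fun h' => h (Subtype.ext h'.symm)
        rw [if_neg h, if_neg h', hψ _ h]; simp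
    · rw [coeff_add, (fxForm_hom _).coeff_eq_zero hm, (fxForm_hom _).coeff_eq_zero hm,
        coeff_monomial, if_neg]
      · simp
      · rintro rfl
        exact hm (fxM0 d k).2
  have h2 : ψ (eval (fxV d k) (fxPre d k e)) = - coeff (fxM0 d k).1 F := by
    have : ψ (eval (fxV d k) (fxPre d k e)) = eval v (map ψ (fxPre d k e)) := by
      rw [eval_map, eval, coe_eval₂Hom, eval₂_comp_left]
      congr 1
      ext i
      exact hψv i
    rw [this, h1, map_sub, hFv]
    simp [eval_monomial, fxM0, hv]
  rw [fxGen, map_sub, map_monomial, h1, h2]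
  simp

/-- The discriminant-type polynomial on the incidence variety. -/
def fxGenD (d : ℕ) (k : Fin 3) : MvPolynomial (FxVar d) ℂ :=
  fxD (fxGen d k Sum.inl) (fxGen d k Sum.inr) (fxV d k) k

open MvPolynomial in
/-- The parametrization of the incidence variety. -/
def fxG (d : ℕ) (k : Fin 3) : FxVar d → MvPolynomial (FxVar d) ℂ :=
  Sum.elim (fun m => coeff m.1 (fxGen d k Sum.inl)) (fun m => coeff m.1 (fxGen d k Sum.inr))

open MvPolynomial in
lemma fx_special {d : ℕ} {k : Fin 3} {F G : MvPolynomial (Fin 3) ℂ}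
    (hF : F.IsHomogeneous d) (hG : G.IsHomogeneous d) {v : Fin 3 → ℂ} (hv : v k = 1)
    (hFv : eval v F = 0) (hGv : eval v G = 0) :
    ∃ ψ : MvPolynomial (FxVar d) ℂ →ₐ[ℂ] ℂ, ψ (fxGenD d k) = fxD F G v k ∧
      ∀ Q, ψ (aeval (fxG d k) Q) =
        eval (fun s : FxVar d => coeffs2 F G (Sum.map Subtype.val Subtype.val s)) Q := by
  classical
  let pt : FxVar d → ℂ := Sum.elim
    (fun m => if m = fxM0 d k then v (k + 1) else coeff m.1 F)
    (fun m => if m = fxM0 d k then v (k + 2) else coeff m.1 G)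
  let ψ : MvPolynomial (FxVar d) ℂ →ₐ[ℂ] ℂ := aeval pt
  have hψv : ∀ i, ψ (fxV d k i) = v i := by
    intro i
    have hi : i = k ∨ i = k + 1 ∨ i = k + 2 := by
      clear * -; revert i k; decide
    have hne1 : k + 1 ≠ k := by clear * -; revert k; decide
    have hne2 : k + 2 ≠ k := by clear * -; revert k; decide
    have hne3 : k + 2 ≠ k + 1 := by clear * -; revert k; decide
    rcases hi with rfl | rfl | rfl
    · simp [fxV, hv]
    · simp [fxV, ψ, pt]
    · simp [fxV, ψ, pt, hne3]
  have hFm : map (ψ : MvPolynomial (FxVar d) ℂ →+* ℂ) (fxGen d k Sum.inl) = F :=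
    fxGen_map hF hv hFv (ψ : MvPolynomial (FxVar d) ℂ →+* ℂ) hψv
      (fun m hm => by simp [ψ, pt, hm])
  have hGm : map (ψ : MvPolynomial (FxVar d) ℂ →+* ℂ) (fxGen d k Sum.inr) = G :=
    fxGen_map hG hv hGv (ψ : MvPolynomial (FxVar d) ℂ →+* ℂ) hψv
      (fun m hm => by simp [ψ, pt, hm])
  refine ⟨ψ, ?_, ?_⟩
  · have := fxD_map (ψ : MvPolynomial (FxVar d) ℂ →+* ℂ) (fxGen d k Sum.inl) (fxGen d k Sum.inr)
      (fxV d k) k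
    rw [hFm, hGm] at this
    have hv' : (fun i => (ψ : MvPolynomial (FxVar d) ℂ →+* ℂ) (fxV d k i)) = v := funext hψv
    rw [hv'] at this
    exact this
  · intro Q
    rw [← AlgHom.comp_apply, comp_aeval]
    rw [← aeval_eq_eval]
    have : (fun i => ψ (fxG d k i)) =
        (fun s : FxVar d => coeffs2 F G (Sum.map Subtype.val Subtype.val s)) := by
      ext s
      rcases s with m | m
      · conv_rhs => rw [← hFm]
        simp [coeffs2, fxG, coeff_map]
      · conv_rhs => rw [← hGm]
        simp [coeffs2, fxG, coeff_map]
    rw [← this]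

open MvPolynomial in
lemma fxGenD_ne_zero {d : ℕ} (hd : 3 ≤ d) (k : Fin 3) : fxGenD d k ≠ 0 := by
  classical
  obtain ⟨n, rfl⟩ : ∃ n, d = n + 2 := ⟨d - 2, by omega⟩
  have hne1 : k + 1 ≠ k := by clear * -; revert k; decide
  have hne2 : k + 2 ≠ k := by clear * -; revert k; decide
  have hne3 : k + 2 ≠ k + 1 := by clear * -; revert k; decide
  let F : MvPolynomial (Fin 3) ℂ := X k ^ (n + 1) * X (k + 1) + X k ^ n * X (k + 2) ^ 2
  let G : MvPolynomial (Fin 3) ℂ := X k ^ (n + 1) * X (k + 2) + X k ^ n * X (k + 1) ^ 2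
  let v : Fin 3 → ℂ := Pi.single k 1
  have hF : F.IsHomogeneous (n + 2) :=
    ((isHomogeneous_X_pow k (n + 1)).mul (isHomogeneous_X ℂ (k + 1))).add
      ((isHomogeneous_X_pow k n).mul (isHomogeneous_X_pow (k + 2) 2))
  have hG : G.IsHomogeneous (n + 2) :=
    ((isHomogeneous_X_pow k (n + 1)).mul (isHomogeneous_X ℂ (k + 2))).add
      ((isHomogeneous_X_pow k n).mul (isHomogeneous_X_pow (k + 1) 2))
  obtain ⟨ψ, hψ, -⟩ := fx_special (k := k) (v := v) hF hG (by simp [v])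
    (by simp [F, v, hne1, hne2]) (by simp [G, v, hne1, hne2])
  intro h
  rw [h, map_zero] at hψ
  apply (show fxD F G v k ≠ 0 from ?_) hψ.symm
  simp [fxD, fxJac, fxCubic, Cubic.discr, F, G, v, hne1, hne2, hne3, hne1.symm, hne2.symm,
    hne3.symm, pderiv_X]

/-- For a general pencil of degree-`d` plane curves and any base point `[v]` of the
pencil, the number of members which are smooth at `[v]` and have a flex at `[v]`
is exactly `3`. -/
theorem flexes_at_base_point_count (d : ℕ) (hd : 3 ≤ d) :
    ∃ Q : MvPolynomial ((Fin 3 →₀ ℕ) ⊕ (Fin 3 →₀ ℕ)) ℂ,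
      (∃ F G : MvPolynomial (Fin 3) ℂ, F.IsHomogeneous d ∧ G.IsHomogeneous d ∧
          LinearIndependent ℂ ![F, G] ∧ MvPolynomial.eval (coeffs2 F G) Q ≠ 0) ∧
      ∀ F G : MvPolynomial (Fin 3) ℂ, F.IsHomogeneous d → G.IsHomogeneous d →
        LinearIndependent ℂ ![F, G] → MvPolynomial.eval (coeffs2 F G) Q ≠ 0 →
          ∀ v : Fin 3 → ℂ, v ≠ 0 →
            MvPolynomial.eval v F = 0 → MvPolynomial.eval v G = 0 →
              (membersWithFlexAt F G v).Finite ∧ (membersWithFlexAt F G v).ncard = 3 := by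
  classical
  have hex : ∀ k : Fin 3, ∃ Q : MvPolynomial (FxVar d) ℂ,
      Q ≠ 0 ∧ fxGenD d k ∣ MvPolynomial.aeval (fxG d k) Q :=
    fun k => fx_elim (fxG d k) (fxGenD d k) (fxGenD_ne_zero hd k)
  choose q hq0 hqd using hex
  have hm : fxM0 d 1 ≠ fxM0 d 0 := by
    intro h
    have := congrArg (fun m => m.1 0) h
    simp [fxM0] at this
    omega
  let R : MvPolynomial (FxVar d) ℂ :=
    MvPolynomial.X (Sum.inl (fxM0 d 0)) * MvPolynomial.X (Sum.inr (fxM0 d 1))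
      - MvPolynomial.X (Sum.inl (fxM0 d 1)) * MvPolynomial.X (Sum.inr (fxM0 d 0))
  have hR : R ≠ 0 := by
    intro h
    have := congrArg (MvPolynomial.eval
      (Sum.elim (Pi.single (fxM0 d 0) 1) (Pi.single (fxM0 d 1) 1) : FxVar d → ℂ)) h
    simp [R, hm] at this
  let Q' : MvPolynomial (FxVar d) ℂ := (∏ k, q k) * R
  have hQ' : Q' ≠ 0 := mul_ne_zero (Finset.prod_ne_zero_iff.mpr fun k _ => hq0 k) hR
  have hev : ∀ F G : MvPolynomial (Fin 3) ℂ, MvPolynomial.eval (coeffs2 F G)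
      (MvPolynomial.rename (Sum.map Subtype.val Subtype.val) Q') =
      MvPolynomial.eval (fun s : FxVar d => coeffs2 F G (Sum.map Subtype.val Subtype.val s)) Q' := by
    intro F G
    rw [MvPolynomial.eval_rename]
    rfl
  refine ⟨MvPolynomial.rename (Sum.map Subtype.val Subtype.val) Q', ?_, ?_⟩
  · obtain ⟨x, hx⟩ : ∃ x, MvPolynomial.eval x Q' ≠ 0 := by
      by_contra hcon
      push Not at hcon
      exact hQ' (MvPolynomial.funext fun x => by rw [hcon x, map_zero])
    refine ⟨fxForm (fun m => x (Sum.inl m)), fxForm (fun m => x (Sum.inr m)), fxForm_hom _,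
      fxForm_hom _, ?_, ?_⟩
    · have hxR : MvPolynomial.eval x R ≠ 0 := by
        intro h
        apply hx
        simp [Q', h]
      simp only [R, map_sub, map_mul, MvPolynomial.eval_X] at hxR
      rw [LinearIndependent.pair_iff]
      intro s t hst
      have c0 := congrArg (MvPolynomial.coeff (fxM0 d 0).1) hst
      have c1 := congrArg (MvPolynomial.coeff (fxM0 d 1).1) hst
      simp only [MvPolynomial.coeff_add, MvPolynomial.coeff_smul, fxForm_coeff, smul_eq_mul,
        MvPolynomial.coeff_zero] at c0 c1
      constructor
      · apply (mul_eq_zero.mp _).resolve_right hxR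
        linear_combination x (Sum.inr (fxM0 d 1)) * c0 - x (Sum.inr (fxM0 d 0)) * c1
      · apply (mul_eq_zero.mp _).resolve_right hxR
        linear_combination x (Sum.inl (fxM0 d 0)) * c1 - x (Sum.inl (fxM0 d 1)) * c0
    · rw [hev]
      convert hx using 3
      ext s
      rcases s with m | m
      · simp [coeffs2, fxForm_coeff]
      · simp [coeffs2, fxForm_coeff]
  · intro F G hF hG _ hQ v hv hFv hGv
    rw [hev] at hQ
    obtain ⟨k, hk⟩ : ∃ k, v k ≠ 0 := by
      by_contra hcon
      push Not at hcon
      exact hv (funext hcon)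
    have hr : (v k)⁻¹ ≠ 0 := inv_ne_zero hk
    rw [← fx_members_smul hF hG v (v k)⁻¹ hr]
    have hFv' : MvPolynomial.eval (fun i => (v k)⁻¹ * v i) F = 0 := by
      have := fx_eval_smul hF (v k)⁻¹ v
      simp only [MvPolynomial.aeval_eq_eval, hFv] at this
      simpa [hFv] using this
    have hGv' : MvPolynomial.eval (fun i => (v k)⁻¹ * v i) G = 0 := by
      have := fx_eval_smul hG (v k)⁻¹ v
      simp only [MvPolynomial.aeval_eq_eval, hGv] at this
      simpa [hGv] using this
    have hv1 : (fun i => (v k)⁻¹ * v i) k = 1 := inv_mul_cancel₀ hk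
    refine fx_count hF hG _ k hv1 hFv' hGv' ?_
    obtain ⟨ψ, h1, h2⟩ := fx_special (k := k) hF hG hv1 hFv' hGv'
    intro h0
    rw [h0] at h1
    have h3 : ψ (MvPolynomial.aeval (fxG d k) (q k)) = 0 := by
      obtain ⟨c, hc⟩ := hqd k
      rw [hc, map_mul, h1, zero_mul]
    rw [h2] at h3
    apply hQ
    simp only [Q', map_mul, map_prod]
    rw [Finset.prod_eq_zero (Finset.mem_univ k) h3, zero_mul]
end
end

section
/- Let d ≥ 2 be an integer. For a general plane curve C of degree d over ℂ (the zero locus of a general degree-d form) and a general point x ∈ ℙ², the number of lines through x that are tangent to C (i.e., have contact order at least 2 with C at some point) is exactly d(d − 1). -/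
noncomputable section

/-- The coefficient vector of a single form. -/
def coeffs1 (F : MvPolynomial (Fin 3) ℂ) : (Fin 3 →₀ ℕ) → ℂ :=
  fun m => MvPolynomial.coeff m F

/-- The set of lines (2-dimensional linear subspaces of `ℂ³`) through the point `[x]`
which are tangent to the curve `{F = 0}`, i.e. have contact order at least 2 with it
at some point. -/
def tangentLinesThrough (F : MvPolynomial (Fin 3) ℂ) (x : Fin 3 → ℂ) :
    Set (Submodule ℂ (Fin 3 → ℂ)) :=
  {W | x ∈ W ∧ Module.finrank ℂ ↥W = 2 ∧
    ∃ v w : Fin 3 → ℂ, v ∈ W ∧ w ∈ W ∧ LinearIndependent ℂ ![v, w] ∧ ContactLE F v w 2}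

open Polynomial in
/-- Weighted degree condition: the coefficient of `t^k` has degree at most `n - k`. -/
def WDeg {A : Type*} [CommRing A] (n : ℕ) (p : A[X][X]) : Prop :=
  ∀ k, p.coeff k ≠ 0 → (p.coeff k).natDegree + k ≤ n

open Polynomial in
lemma WDeg.mul {A : Type*} [CommRing A] {m n : ℕ} {p q : A[X][X]}
    (hp : WDeg m p) (hq : WDeg n q) : WDeg (m + n) (p * q) := by
  intro k hk
  rw [coeff_mul] at hk ⊢
  obtain ⟨⟨i, j⟩, hij, hne⟩ := Finset.exists_ne_zero_of_sum_ne_zero hk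
  have hle : ∀ ij ∈ Finset.HasAntidiagonal.antidiagonal k,
      (p.coeff ij.1 * q.coeff ij.2) ≠ 0 →
      (p.coeff ij.1 * q.coeff ij.2).natDegree + k ≤ m + n := by
    rintro ⟨i, j⟩ hij hne
    rw [Finset.HasAntidiagonal.mem_antidiagonal] at hij
    have h1 := hp i (left_ne_zero_of_mul hne)
    have h2 := hq j (right_ne_zero_of_mul hne)
    have h3 := natDegree_mul_le (p := p.coeff i) (q := q.coeff j)
    simp only at hij ⊢
    omega
  have hk' : k ≤ m + n := by
    have := hle _ hij hne
    omega
  have := natDegree_sum_le_of_forall_le (n := m + n - k) (Finset.HasAntidiagonal.antidiagonal k)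
    (fun ij : ℕ × ℕ => p.coeff ij.1 * q.coeff ij.2) (by
      intro ij hij
      by_cases h : p.coeff ij.1 * q.coeff ij.2 = 0
      · simp [h]
      · have := hle ij hij h
        omega)
  omega

open Polynomial in
lemma WDeg.add {A : Type*} [CommRing A] {n : ℕ} {p q : A[X][X]}
    (hp : WDeg n p) (hq : WDeg n q) : WDeg n (p + q) := by
  intro k hk
  rw [coeff_add] at hk ⊢
  have h3 := natDegree_add_le (p.coeff k) (q.coeff k)
  by_cases h1 : p.coeff k = 0
  · rw [h1, zero_add] at hk ⊢
    exact hq k hk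
  by_cases h2 : q.coeff k = 0
  · rw [h2, add_zero] at hk ⊢
    exact hp k hk
  have := hp k h1
  have := hq k h2
  omega

open Polynomial in
lemma WDeg.sum {A ι : Type*} [CommRing A] {n : ℕ} (s : Finset ι) (p : ι → A[X][X])
    (hp : ∀ i ∈ s, WDeg n (p i)) : WDeg n (∑ i ∈ s, p i) := by
  classical
  induction s using Finset.induction_on with
  | empty => intro k hk; simp at hk
  | insert a s ha ih =>
    rw [Finset.sum_insert ha]
    exact (hp a (by simp)).add (ih fun i hi => hp i (by simp [hi]))

open Polynomial in
lemma WDeg.pow {A : Type*} [CommRing A] {n : ℕ} {p : A[X][X]}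
    (hp : WDeg n p) (k : ℕ) : WDeg (k * n) (p ^ k) := by
  induction k with
  | zero =>
    intro k hk
    rw [pow_zero, coeff_one] at *
    split_ifs at * with h
    · simp [h]
    · simp at hk
  | succ k ih =>
    rw [pow_succ, Nat.succ_mul]
    exact ih.mul hp

open Polynomial in
lemma WDeg.C {A : Type*} [CommRing A] {n : ℕ} {a : A[X]} (h : a.natDegree ≤ n) :
    WDeg n (Polynomial.C a) := by
  intro k hk
  rw [coeff_C] at *
  split_ifs at * with h'
  · omega
  · simp at hk

open Polynomial in
lemma WDeg.derivative {A : Type*} [CommRing A] {n : ℕ} {p : A[X][X]}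
    (hp : WDeg n p) : WDeg (n - 1) (derivative p) := by
  intro k hk
  rw [coeff_derivative] at *
  have := hp (k + 1) (left_ne_zero_of_mul hk)
  have h3 := natDegree_mul_le (p := p.coeff (k + 1)) (q := ((k : A[X]) + 1))
  have h4 : ((k : A[X]) + 1).natDegree = 0 := by
    have := natDegree_natCast (R := A) (k + 1)
    rwa [Nat.cast_add, Nat.cast_one] at this
  omega

open Polynomial in
lemma natDegree_resultant_le {A : Type*} [CommRing A] {m n : ℕ} {p q : A[X][X]}
    (hp : WDeg m p) (hq : WDeg n q) : (resultant p q m n).natDegree ≤ m * n := by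
  rw [resultant, Matrix.det_apply]
  apply natDegree_sum_le_of_forall_le
  intro σ _
  refine le_trans (natDegree_smul_le _ _) ?_
  by_cases h0 : ∏ i, sylvester p q m n (σ i) i = 0
  · simp [h0]
  have hent : ∀ i j, sylvester p q m n i j ≠ 0 →
      (sylvester p q m n i j).natDegree + (i : ℕ) ≤ (j : ℕ) + if (j : ℕ) < m then n else 0 := by
    intro i j
    induction j using Fin.addCases with
    | left j =>
      simp only [sylvester, Matrix.of_apply, Fin.addCases_left, Set.mem_Icc, Fin.val_castAdd]
      split_ifs with h1 h2 h2
      · intro h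
        have := hq _ h
        omega
      · exact absurd j.2 h2
      · simp
      · simp
    | right j =>
      simp only [sylvester, Matrix.of_apply, Fin.addCases_right, Set.mem_Icc, Fin.val_natAdd]
      split_ifs with h1 h2 h2
      · omega
      · intro h
        have := hp _ h
        omega
      · simp
      · simp
  have hprod := natDegree_prod_le Finset.univ (fun i => sylvester p q m n (σ i) i)
  have hs : ∑ i, ((sylvester p q m n (σ i) i).natDegree + ((σ i : Fin (m + n)) : ℕ)) ≤
      ∑ j : Fin (m + n), ((j : ℕ) + if (j : ℕ) < m then n else 0) := by
    apply Finset.sum_le_sum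
    intro i _
    apply hent
    intro h
    exact h0 (Finset.prod_eq_zero (Finset.mem_univ i) h)
  rw [Finset.sum_add_distrib, Finset.sum_add_distrib,
    Equiv.sum_comp σ (fun i : Fin (m + n) => (i : ℕ))] at hs
  have hc : ∑ j : Fin (m + n), (if (j : ℕ) < m then n else 0) = m * n := by
    rw [Fin.sum_univ_add]
    simp
  have hprod' : (∏ i, sylvester p q m n (σ i) i).natDegree ≤
    ∑ i, (sylvester p q m n (σ i) i).natDegree := hprod
  omega

open Polynomial in
/-- The restriction of the degree `d` form with coefficients `c` to the line `u + t x`. -/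
def gp {A : Type*} [CommRing A] (d : ℕ) (c : (Fin 3 →₀ ℕ) → A) (u x : Fin 3 → A) : A[X] :=
  ∑ m ∈ Finset.finsuppAntidiag Finset.univ d, C (c m) * ∏ i, (C (u i) + X * C (x i)) ^ (m i)

open Polynomial in
lemma gp_map {A B : Type*} [CommRing A] [CommRing B] (f : A →+* B) (d : ℕ)
    (c : (Fin 3 →₀ ℕ) → A) (u x : Fin 3 → A) :
    (gp d c u x).map f = gp d (f ∘ c) (f ∘ u) (f ∘ x) := by
  simp [gp, Polynomial.map_sum, Polynomial.map_prod]

open Polynomial in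
lemma gp_wdeg {A : Type*} [CommRing A] (d : ℕ)
    (c : (Fin 3 →₀ ℕ) → A) (u : Fin 3 → A[X]) (hu : ∀ i, (u i).natDegree ≤ 1) (x : Fin 3 → A) :
    WDeg d (gp d (C ∘ c) u (C ∘ x)) := by
  apply WDeg.sum
  intro m hm
  rw [Finset.mem_finsuppAntidiag] at hm
  have hl : ∀ i, WDeg 1 (C (u i) + X * C ((C ∘ x) i)) := by
    intro i
    apply WDeg.add
    · exact WDeg.C (hu i)
    · have h1 : WDeg 1 (X : A[X][X]) := by
        intro k hk
        rw [coeff_X] at *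
        split_ifs at * with h
        · simp [← h]
        · simp at hk
      exact h1.mul (n := 0) (WDeg.C (by simp))
  have h := (WDeg.C (n := 0) (a := (C ∘ c) m) (by simp)).mul
    ((((hl 0).pow (m 0)).mul ((hl 1).pow (m 1))).mul ((hl 2).pow (m 2)))
  have h2 := hm.1
  rw [Fin.sum_univ_three] at h2
  rw [Fin.prod_univ_three]
  simpa [h2] using h

lemma linePoly_eq_gp {d : ℕ} {F : MvPolynomial (Fin 3) ℂ} (hF : F.IsHomogeneous d)
    (v w : Fin 3 → ℂ) : linePoly F v w = gp d (coeffs1 F) v w := by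
  rw [linePoly, MvPolynomial.aeval_def, MvPolynomial.eval₂_eq', gp]
  apply Finset.sum_subset_zero_on_sdiff
  · intro m hm
    rw [Finset.mem_finsuppAntidiag]
    refine ⟨?_, by simp⟩
    have := hF (MvPolynomial.mem_support_iff.1 hm)
    rw [Finsupp.weight_apply, Finsupp.sum_fintype _ _ (by simp)] at this
    simpa using this
  · intro m hm
    rw [Finset.mem_sdiff, MvPolynomial.mem_support_iff, not_not] at hm
    simp [coeffs1, hm.2]
  · intro m hm
    rfl

open Polynomial in
/-- The discriminant polynomial in the slope `b` of lines through `x`. -/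
def discB {A : Type*} [CommRing A] (d : ℕ) (c : (Fin 3 →₀ ℕ) → A) (x : Fin 3 → A) : A[X] :=
  resultant (gp d (C ∘ c) ![1, X, 0] (C ∘ x)) (derivative (gp d (C ∘ c) ![1, X, 0] (C ∘ x)))
    d (d - 1)

open Polynomial in
/-- The universal open condition. -/
def qpoly {A : Type*} [CommRing A] (d : ℕ) (c : (Fin 3 →₀ ℕ) → A) (x : Fin 3 → A) : A :=
  x 2 * (gp d c 0 x).coeff d
    * resultant (gp d c ![0, 1, 0] x) (derivative (gp d c ![0, 1, 0] x)) d (d - 1)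
    * (discB d c x).coeff (d * (d - 1))
    * resultant (discB d c x) (derivative (discB d c x)) (d * (d - 1)) (d * (d - 1) - 1)

open Polynomial in
lemma discB_map {A B : Type*} [CommRing A] [CommRing B] (f : A →+* B) (d : ℕ)
    (c : (Fin 3 →₀ ℕ) → A) (x : Fin 3 → A) :
    (discB d c x).map f = discB d (f ∘ c) (f ∘ x) := by
  have h : (mapRingHom f) ∘ ![1, X, 0] = ![1, X, 0] := by
    funext i; fin_cases i <;> simp
  have h1 : ∀ {ι : Type} (g : ι → A), (mapRingHom f) ∘ (C ∘ g) = C ∘ (f ∘ g) := by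
    intro ι g; funext i; simp
  rw [discB, ← coe_mapRingHom, ← resultant_map_map, ← derivative_map, gp_map, h, h1, h1, discB]

open Polynomial in
lemma qpoly_map {A B : Type*} [CommRing A] [CommRing B] (f : A →+* B) (d : ℕ)
    (c : (Fin 3 →₀ ℕ) → A) (x : Fin 3 → A) :
    f (qpoly d c x) = qpoly d (f ∘ c) (f ∘ x) := by
  have h : f ∘ ![0, 1, 0] = ![0, 1, 0] := by
    funext i; fin_cases i <;> simp
  have h0 : f ∘ (0 : Fin 3 → A) = 0 := by
    funext i; simp
  simp only [qpoly, map_mul]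
  rw [← resultant_map_map, ← resultant_map_map, ← derivative_map, ← derivative_map, gp_map, h,
    discB_map, ← coeff_map, ← coeff_map, gp_map, discB_map, h0]
  rfl

open Polynomial in
lemma discB_eval {d : ℕ} {F : MvPolynomial (Fin 3) ℂ} (hF : F.IsHomogeneous d)
    (x : Fin 3 → ℂ) (b : ℂ) : (discB d (coeffs1 F) x).eval b =
      resultant (linePoly F ![1, b, 0] x) (derivative (linePoly F ![1, b, 0] x)) d (d - 1) := by
  have h : (evalRingHom b) ∘ ![1, X, 0] = ![1, b, 0] := by
    funext i; fin_cases i <;> simp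
  have h1 : ∀ {ι : Type} (g : ι → ℂ), (evalRingHom b) ∘ (C ∘ g) = g := by
    intro ι g; funext i; simp
  rw [discB, ← coe_evalRingHom, ← resultant_map_map, ← derivative_map, gp_map, h, h1, h1,
    linePoly_eq_gp hF]

lemma discB_natDegree_le (d : ℕ) (c : (Fin 3 →₀ ℕ) → ℂ) (x : Fin 3 → ℂ) :
    (discB d c x).natDegree ≤ d * (d - 1) := by
  have h := gp_wdeg d c ![1, Polynomial.X, 0] (by intro i; fin_cases i <;> simp) x
  exact natDegree_resultant_le h h.derivative

open Polynomial in
lemma gp_natDegree_coeff {A : Type*} [CommRing A] (d : ℕ) (c : (Fin 3 →₀ ℕ) → A)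
    (u x : Fin 3 → A) :
    (gp d c u x).natDegree ≤ d ∧ (gp d c u x).coeff d = (gp d c 0 x).eval 1 := by
  have hl : ∀ i, (C (u i) + X * C (x i)).natDegree ≤ 1 := by
    intro i
    rw [add_comm, mul_comm]
    exact natDegree_linear_le
  have hp : ∀ i (k : ℕ), ((C (u i) + X * C (x i)) ^ k).natDegree ≤ k := by
    intro i k
    simpa using natDegree_pow_le_of_le k (hl i)
  have hc : ∀ i (k : ℕ), ((C (u i) + X * C (x i)) ^ k).coeff k = x i ^ k := by
    intro i k
    have := coeff_pow_of_natDegree_le (m := k) (hl i)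
    rw [mul_one] at this
    rw [this]
    simp
  constructor
  · apply natDegree_sum_le_of_forall_le
    intro m hm
    rw [Finset.mem_finsuppAntidiag, Fin.sum_univ_three] at hm
    rw [Fin.prod_univ_three, ← hm.1]
    refine (natDegree_C_mul_le _ _).trans ?_
    exact natDegree_mul_le_of_le (natDegree_mul_le_of_le (hp _ _) (hp _ _)) (hp _ _)
  · rw [gp, gp, finsetSum_coeff, eval_finsetSum]
    apply Finset.sum_congr rfl
    intro m hm
    rw [Finset.mem_finsuppAntidiag, Fin.sum_univ_three] at hm
    rw [Fin.prod_univ_three, Fin.prod_univ_three, coeff_C_mul, ← hm.1,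
      coeff_mul_add_eq_of_natDegree_le (natDegree_mul_le_of_le (hp _ _) (hp _ _)) (hp _ _),
      coeff_mul_add_eq_of_natDegree_le (hp _ _) (hp _ _), hc, hc, hc]
    simp

open Polynomial in
lemma linePoly_eval (F : MvPolynomial (Fin 3) ℂ) (v w : Fin 3 → ℂ) (t : ℂ) :
    (linePoly F v w).eval t = MvPolynomial.eval (v + t • w) F := by
  induction F using MvPolynomial.induction_on with
  | C a => simp [linePoly]
  | add p q hp hq => simp only [linePoly, map_add, eval_add] at *; rw [hp, hq]
  | mul_X p i hp => simp only [linePoly, map_mul, eval_mul] at *; rw [hp]; simp [mul_comm t]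

open Polynomial in
lemma linePoly_deriv_eval (F : MvPolynomial (Fin 3) ℂ) (v w : Fin 3 → ℂ) (t : ℂ) :
    (derivative (linePoly F v w)).eval t =
      ∑ i, w i * MvPolynomial.eval (v + t • w) (MvPolynomial.pderiv i F) := by
  induction F using MvPolynomial.induction_on with
  | C a => simp [linePoly]
  | add p q hp hq =>
    simp only [linePoly, map_add, eval_add, mul_add, Finset.sum_add_distrib] at *; rw [hp, hq]
  | mul_X p i hp =>
    have h := linePoly_eval p v w t
    have h1 : linePoly (p * MvPolynomial.X i) v w = linePoly p v w * (C (v i) + X * C (w i)) := by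
      simp [linePoly]
    rw [h1, derivative_mul, eval_add, eval_mul, eval_mul, hp, h]
    simp only [Derivation.leibniz, map_add, smul_eq_mul, map_mul, MvPolynomial.eval_X, mul_add,
      Finset.sum_add_distrib, MvPolynomial.pderiv_X]
    rw [add_comm]
    congr 1
    · rw [Finset.sum_eq_single i]
      · simp; ring
      · intro j _ hj; simp [Pi.single_apply, hj.symm]
      · simp
    · rw [Finset.sum_mul]
      apply Finset.sum_congr rfl
      intro j _
      simp; ring

open Polynomial in
lemma contact_iff (F : MvPolynomial (Fin 3) ℂ) (v w : Fin 3 → ℂ) :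
    ContactLE F v w 2 ↔ MvPolynomial.eval v F = 0 ∧
      ∑ i, w i * MvPolynomial.eval v (MvPolynomial.pderiv i F) = 0 := by
  have h1 := linePoly_eval F v w 0
  have h2 := linePoly_deriv_eval F v w 0
  rw [zero_smul, add_zero] at h1 h2
  rw [← h1, ← h2, ContactLE, X_pow_dvd_iff, ← coeff_zero_eq_eval_zero, ← coeff_zero_eq_eval_zero,
    coeff_derivative]
  constructor
  · intro h
    simp [h 0, h 1]
  · rintro ⟨ha, hb⟩ k hk
    interval_cases k
    · exact ha
    · simpa using hb

open Polynomial in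
/-- `t` is a double root of the restriction of `F` to the line `u + t x`. -/
def DoubleRoot (F : MvPolynomial (Fin 3) ℂ) (u x : Fin 3 → ℂ) (t : ℂ) : Prop :=
  (linePoly F u x).eval t = 0 ∧ (derivative (linePoly F u x)).eval t = 0

open Polynomial in
lemma resultant_deriv_eq_zero_iff {f : ℂ[X]} {n : ℕ} (hf : f.natDegree ≤ n) (hc : f.coeff n ≠ 0) :
    resultant f (derivative f) n (n - 1) = 0 ↔
      ∃ t, f.eval t = 0 ∧ (derivative f).eval t = 0 := by
  have hn : f.natDegree = n := le_antisymm hf (le_natDegree_of_ne_zero hc)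
  have hf0 : f ≠ 0 := by rintro rfl; simp at hc
  subst hn
  rw [resultant_eq_prod_eval _ _ _ (natDegree_derivative_le f) (IsAlgClosed.splits f)]
  rw [mul_eq_zero, or_iff_right (pow_ne_zero _ (leadingCoeff_ne_zero.2 hf0)),
    Multiset.prod_eq_zero_iff, Multiset.mem_map]
  simp [hf0]

lemma linePoly_degree {d : ℕ} {F : MvPolynomial (Fin 3) ℂ} (hF : F.IsHomogeneous d)
    (u x : Fin 3 → ℂ) : (linePoly F u x).natDegree ≤ d ∧
      (linePoly F u x).coeff d = MvPolynomial.eval x F := by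
  have h := gp_natDegree_coeff d (coeffs1 F) u x
  rw [← linePoly_eq_gp hF, ← linePoly_eq_gp hF, linePoly_eval] at h
  simpa using h

lemma eval_smul_homog {d : ℕ} {F : MvPolynomial (Fin 3) ℂ} (hF : F.IsHomogeneous d)
    (a : ℂ) (x : Fin 3 → ℂ) :
    MvPolynomial.eval (a • x) F = a ^ d * MvPolynomial.eval x F := by
  rw [MvPolynomial.eval_eq', MvPolynomial.eval_eq', Finset.mul_sum]
  apply Finset.sum_congr rfl
  intro m hm
  have := hF (MvPolynomial.mem_support_iff.1 hm)
  rw [Finsupp.weight_apply, Finsupp.sum_fintype _ _ (by simp)] at this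
  rw [← this]
  simp [Fin.sum_univ_three, Fin.prod_univ_three, mul_pow, pow_add]
  ring

lemma mem_pair_span_eq {W : Submodule ℂ (Fin 3 → ℂ)} (hW : Module.finrank ℂ W = 2)
    {v w : Fin 3 → ℂ} (hv : v ∈ W) (hw : w ∈ W) (h : LinearIndependent ℂ ![v, w]) :
    Submodule.span ℂ {v, w} = W := by
  apply Submodule.eq_of_le_of_finrank_eq
  · rw [Submodule.span_le]
    rintro y (rfl | rfl) <;> assumption
  · rw [hW]
    have := finrank_span_eq_card h
    rw [Matrix.range_cons_cons_empty] at this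
    simpa using this

lemma indep_x_u {x : Fin 3 → ℂ} (hx : x 2 ≠ 0) (b : ℂ) :
    LinearIndependent ℂ ![x, ![1, b, 0]] := by
  rw [LinearIndependent.pair_iff]
  intro s t h
  have h2 := congrFun h 2
  have h0 := congrFun h 0
  simp [hx] at h2
  subst h2
  simpa using h0

lemma tangent_eq_image {d : ℕ} {F : MvPolynomial (Fin 3) ℂ} (hF : F.IsHomogeneous d) (hd : d ≠ 0)
    {x : Fin 3 → ℂ} (hx : x 2 ≠ 0) (hFx : MvPolynomial.eval x F ≠ 0)
    (hinf : ¬ ∃ t, DoubleRoot F ![0, 1, 0] x t) :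
    tangentLinesThrough F x = (fun b : ℂ => Submodule.span ℂ {x, ![1, b, 0]}) ''
      {b | ∃ t, DoubleRoot F ![1, b, 0] x t} := by
  ext W
  constructor
  · rintro ⟨hxW, hW, v, w, hv, hw, hvw, hc⟩
    rw [contact_iff] at hc
    obtain ⟨hc0, hc1⟩ := hc
    have hc2 : ∑ i, v i * MvPolynomial.eval v (MvPolynomial.pderiv i F) = 0 := by
      have := congrArg (MvPolynomial.eval v) hF.sum_X_mul_pderiv
      simpa [hc0] using this
    have hxs : x ∈ Submodule.span ℂ {v, w} := by rw [mem_pair_span_eq hW hv hw hvw]; exact hxW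
    obtain ⟨α, β, hαβ⟩ := Submodule.mem_span_pair.1 hxs
    have hc3 : ∑ i, x i * MvPolynomial.eval v (MvPolynomial.pderiv i F) = 0 := by
      rw [← hαβ]
      simp only [Pi.add_apply, Pi.smul_apply, smul_eq_mul, add_mul, Finset.sum_add_distrib,
        mul_assoc, ← Finset.mul_sum, hc1, hc2]
      simp
    have hv0 : v ≠ 0 := by
      have := hvw.ne_zero 0
      simpa using this
    -- key: doubling from a decomposition of a multiple of `v`
    have key : ∀ (r t : ℂ) (u : Fin 3 → ℂ), r • v = u + t • x → DoubleRoot F u x t := by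
      intro r t u h
      constructor
      · rw [linePoly_eval, ← h, eval_smul_homog hF, hc0, mul_zero]
      · rw [linePoly_deriv_eval, ← h]
        have h2 : ∀ i, MvPolynomial.eval (r • v) (MvPolynomial.pderiv i F) =
            r ^ (d - 1) * MvPolynomial.eval v (MvPolynomial.pderiv i F) :=
          fun i => eval_smul_homog hF.pderiv r v
        simp only [h2, mul_left_comm (x _), ← Finset.mul_sum, hc3, mul_zero]
    set s := v 2 / x 2 with hs
    have hs2 : s * x 2 = v 2 := by rw [hs]; field_simp
    by_cases hp : v 0 - s * x 0 = 0
    · exfalso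
      by_cases hq : v 1 - s * x 1 = 0
      · have hvs : v = s • x := by
          funext i
          fin_cases i
          · simpa using sub_eq_zero.1 hp
          · simpa using sub_eq_zero.1 hq
          · simpa using hs2.symm
        rw [hvs, eval_smul_homog hF] at hc0
        have : s ≠ 0 := by rintro h; apply hv0; rw [hvs, h, zero_smul]
        exact (mul_ne_zero (pow_ne_zero _ this) hFx) hc0
      · apply hinf
        refine ⟨(v 1 - s * x 1)⁻¹ * s, key (v 1 - s * x 1)⁻¹ _ _ ?_⟩
        funext i
        fin_cases i
        · simp; rw [sub_eq_zero.1 hp]; ring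
        · simp; field_simp; ring
        · simp; rw [← hs2]; ring
    · set r := (v 0 - s * x 0)⁻¹ with hr
      have hdec : r • v = ![1, r * (v 1 - s * x 1), 0] + (r * s) • x := by
        funext i
        fin_cases i
        · simp [hr]; field_simp; ring
        · simp; ring
        · simp; rw [← hs2]; ring
      refine ⟨r * (v 1 - s * x 1), ⟨r * s, key r _ _ hdec⟩, ?_⟩
      apply mem_pair_span_eq hW hxW _ (indep_x_u hx _)
      rw [← sub_eq_iff_eq_add] at hdec
      rw [← hdec]
      exact W.sub_mem (W.smul_mem _ hv) (W.smul_mem _ hxW)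
  · rintro ⟨b, ⟨t, ht0, ht1⟩, rfl⟩
    have hi := indep_x_u hx b
    refine ⟨Submodule.subset_span (by simp), ?_, ![1, b, 0] + t • x, x, ?_, ?_, ?_, ?_⟩
    · have := finrank_span_eq_card hi
      rw [Matrix.range_cons_cons_empty] at this
      simpa using this
    · exact Submodule.add_mem _ (Submodule.subset_span (by simp))
        (Submodule.smul_mem _ _ (Submodule.subset_span (by simp)))
    · exact Submodule.subset_span (by simp)
    · rw [LinearIndependent.pair_iff] at hi ⊢
      intro p q h
      have := hi (p * t + q) p (by rw [← h]; module)
      obtain ⟨h1, h2⟩ := this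
      subst h2
      simpa using h1
    · rw [contact_iff]
      rw [linePoly_eval] at ht0
      rw [linePoly_deriv_eval] at ht1
      exact ⟨ht0, ht1⟩

lemma line_injective {x : Fin 3 → ℂ} (hx : x 2 ≠ 0) :
    Function.Injective (fun b : ℂ => Submodule.span ℂ {x, ![1, b, 0]}) := by
  intro b b' h
  have h1 : ![1, b, 0] ∈ Submodule.span ℂ {x, ![1, b', 0]} := by
    rw [← show Submodule.span ℂ {x, ![1, b, 0]} = Submodule.span ℂ {x, ![1, b', 0]} from h]
    exact Submodule.subset_span (by simp)
  obtain ⟨p, q, hpq⟩ := Submodule.mem_span_pair.1 h1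
  have h2 := congrFun hpq 2
  have h0 := congrFun hpq 0
  have h1 := congrFun hpq 1
  simp [hx] at h2
  subst h2
  simp at h0 h1
  subst h0
  simpa using h1.symm

open Polynomial in
lemma roots_count {f : ℂ[X]} {n : ℕ} (hf : f.natDegree ≤ n) (hc : f.coeff n ≠ 0)
    (hr : resultant f (derivative f) n (n - 1) ≠ 0) : f.roots.toFinset.card = n := by
  have hn : f.natDegree = n := le_antisymm hf (le_natDegree_of_ne_zero hc)
  have hf0 : f ≠ 0 := by rintro rfl; simp at hc
  rw [Ne, resultant_deriv_eq_zero_iff hf hc] at hr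
  rw [Multiset.toFinset_card_of_nodup, ← hn]
  · exact (IsAlgClosed.splits f).natDegree_eq_card_roots.symm
  · rw [Multiset.nodup_iff_count_le_one]
    intro a
    rw [count_roots]
    by_contra! h
    rw [one_lt_rootMultiplicity_iff_isRoot hf0] at h
    exact hr ⟨a, h.1, h.2⟩

open Polynomial in
lemma roots_count_conv {f : ℂ[X]} {n : ℕ} (hf : f.natDegree ≤ n) (hf0 : f ≠ 0)
    (S : Finset ℂ) (hS : n ≤ S.card) (hr : ∀ b ∈ S, f.eval b = 0) :
    f.coeff n ≠ 0 ∧ resultant f (derivative f) n (n - 1) ≠ 0 := by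
  have hsub : S ⊆ f.roots.toFinset := by
    intro b hb
    simp [hf0, hr b hb]
  have h1 := Finset.card_le_card hsub
  have h2 := Multiset.toFinset_card_le f.roots
  have h3 := card_roots' f
  have hn : f.natDegree = n := by omega
  have hc : f.coeff n ≠ 0 := by rw [← hn]; exact leadingCoeff_ne_zero.2 hf0
  refine ⟨hc, ?_⟩
  rw [Ne, resultant_deriv_eq_zero_iff hf hc]
  rintro ⟨t, ht⟩
  have hnd : f.roots.Nodup := by
    rw [← Multiset.toFinset_card_eq_card_iff_nodup]; omega
  have h4 := (one_lt_rootMultiplicity_iff_isRoot (t := t) hf0).2 ht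
  rw [← count_roots] at h4
  have := Multiset.nodup_iff_count_le_one.1 hnd t
  omega

open Polynomial in
lemma exists_nth_roots {n : ℕ} (hn : 0 < n) {a : ℂ} (ha : a ≠ 0) :
    ∃ S : Finset ℂ, S.card = n ∧ ∀ z ∈ S, z ^ n = a := by
  refine ⟨(X ^ n - C a).roots.toFinset, ?_, ?_⟩
  · have hdeg : (X ^ n - C a).natDegree = n := natDegree_X_pow_sub_C
    apply roots_count hdeg.le
    · rw [coeff_sub, coeff_X_pow, coeff_C]; simp [hn.ne']
    · rw [Ne, resultant_deriv_eq_zero_iff hdeg.le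
        (by rw [coeff_sub, coeff_X_pow, coeff_C]; simp [hn.ne'])]
      rintro ⟨t, h1, h2⟩
      rw [derivative_sub, derivative_X_pow, derivative_C] at h2
      simp [hn.ne'] at h1 h2
      rw [h2.1, zero_pow hn.ne'] at h1
      simp at h1
      exact ha h1
  · intro z hz
    have := (mem_roots'.1 (Multiset.mem_toFinset.1 hz)).2
    simpa [sub_eq_zero] using this

lemma example_set {d : ℕ} (hd : 2 ≤ d) : ∃ S : Finset ℂ, S.card = d * (d - 1) ∧
    ∀ b ∈ S, ∃ t : ℂ, t ^ d + t + b ^ d = 0 ∧ d * t ^ (d - 1) + 1 = 0 := by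
  have hd0 : (d : ℂ) ≠ 0 := by exact_mod_cast (by omega : d ≠ 0)
  have hd1 : (d : ℂ) - 1 ≠ 0 := by
    rw [sub_ne_zero]; exact_mod_cast (by omega : d ≠ 1)
  obtain ⟨T, hT, hTr⟩ := exists_nth_roots (n := d - 1) (by omega) (a := -(d : ℂ)⁻¹)
    (neg_ne_zero.2 (inv_ne_zero hd0))
  have hTd : ∀ t ∈ T, t ^ d + t = (((d : ℂ) - 1) / d) * t := by
    intro t ht
    have : t ^ d = t ^ (d - 1) * t := by rw [← pow_succ]; congr 1; omega
    rw [this, hTr t ht]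
    field_simp
    ring
  have hT0 : ∀ t ∈ T, t ≠ 0 := by
    rintro t ht rfl
    have := hTr 0 ht
    rw [zero_pow (by omega)] at this
    exact (neg_ne_zero.2 (inv_ne_zero hd0)) this.symm
  have hB : ∀ t : ℂ, ∃ S : Finset ℂ, t ∈ T → S.card = d ∧ ∀ z ∈ S, z ^ d = -(t ^ d + t) := by
    intro t
    by_cases ht : t ∈ T
    · obtain ⟨S, hS⟩ := exists_nth_roots (n := d) (by omega) (a := -(t ^ d + t)) (by
        rw [neg_ne_zero, hTd t ht]
        exact mul_ne_zero (div_ne_zero hd1 hd0) (hT0 t ht))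
      exact ⟨S, fun _ => hS⟩
    · exact ⟨∅, fun h => absurd h ht⟩
  choose B hB using hB
  refine ⟨T.biUnion B, ?_, ?_⟩
  · rw [Finset.card_biUnion]
    · rw [Finset.sum_congr rfl (fun t ht => (hB t ht).1)]
      simp [hT, mul_comm]
    · intro t ht t' ht' hne
      rw [Function.onFun, Finset.disjoint_left] 
      intro z hz hz'
      have h1 := (hB t ht).2 z hz
      have h2 := (hB t' ht').2 z hz'
      rw [h1, hTd t ht, hTd t' ht', neg_inj] at h2
      exact hne (mul_left_cancel₀ (div_ne_zero hd1 hd0) h2)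
  · intro b hb
    obtain ⟨t, ht, hbt⟩ := Finset.mem_biUnion.1 hb
    refine ⟨t, ?_, ?_⟩
    · rw [(hB t ht).2 b hbt]; ring
    · rw [hTr t ht]; field_simp; ring

/-- The explicit example curve `z^d + x^(d-1) z + y^d`. -/
def exF (d : ℕ) : MvPolynomial (Fin 3) ℂ :=
  MvPolynomial.X 2 ^ d + MvPolynomial.X 0 ^ (d - 1) * MvPolynomial.X 2 + MvPolynomial.X 1 ^ d

lemma exF_homog {d : ℕ} (hd : 2 ≤ d) : (exF d).IsHomogeneous d := by
  refine ((MvPolynomial.isHomogeneous_X_pow 2 d).add ?_).add (MvPolynomial.isHomogeneous_X_pow 1 d)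
  have := (MvPolynomial.isHomogeneous_X_pow (R := ℂ) (0 : Fin 3) (d - 1)).mul
    (MvPolynomial.isHomogeneous_X ℂ (2 : Fin 3))
  rwa [Nat.sub_add_cancel (by omega)] at this

lemma qpoly_ne_zero_iff {d : ℕ} (hd : 2 ≤ d) {F : MvPolynomial (Fin 3) ℂ} (hF : F.IsHomogeneous d)
    (x : Fin 3 → ℂ) : qpoly d (coeffs1 F) x ≠ 0 ↔
      x 2 ≠ 0 ∧ MvPolynomial.eval x F ≠ 0 ∧ (¬ ∃ t, DoubleRoot F ![0, 1, 0] x t) ∧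
      (discB d (coeffs1 F) x).coeff (d * (d - 1)) ≠ 0 ∧
      (discB d (coeffs1 F) x).resultant (Polynomial.derivative (discB d (coeffs1 F) x))
        (d * (d - 1)) (d * (d - 1) - 1) ≠ 0 := by
  rw [qpoly, ← linePoly_eq_gp hF, ← linePoly_eq_gp hF, (linePoly_degree hF _ _).2]
  simp only [mul_ne_zero_iff, and_assoc]
  refine and_congr_right fun _ => and_congr_right fun h => and_congr_left fun _ => ?_
  have hl := linePoly_degree hF ![0, 1, 0] x
  rw [Ne, resultant_deriv_eq_zero_iff hl.1 (by rw [hl.2]; exact h)]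
  rfl

lemma discB_root_iff {d : ℕ} {F : MvPolynomial (Fin 3) ℂ} (hF : F.IsHomogeneous d)
    {x : Fin 3 → ℂ} (hFx : MvPolynomial.eval x F ≠ 0) (b : ℂ) :
    (discB d (coeffs1 F) x).eval b = 0 ↔ ∃ t, DoubleRoot F ![1, b, 0] x t := by
  have hl := linePoly_degree hF ![1, b, 0] x
  rw [discB_eval hF, resultant_deriv_eq_zero_iff hl.1 (by rw [hl.2]; exact hFx)]
  rfl

open Polynomial in
lemma example_ok {d : ℕ} (hd : 2 ≤ d) : qpoly d (coeffs1 (exF d)) ![0, 0, 1] ≠ 0 := by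
  have hd0 : (d : ℂ) ≠ 0 := by exact_mod_cast (by omega : d ≠ 0)
  have hd2 : d ≠ 0 := by omega
  have hd3 : d - 1 ≠ 0 := by omega
  have hF := exF_homog hd
  have hFx : MvPolynomial.eval ![0, 0, 1] (exF d) ≠ 0 := by
    simp [exF, hd2, hd3]
  have hl : ∀ a b : ℂ, linePoly (exF d) ![a, b, 0] ![0, 0, 1] =
      X ^ d + C (a ^ (d - 1)) * X + C (b ^ d) := by
    intro a b
    simp [exF, linePoly]
  have hdr : ∀ a b t : ℂ, DoubleRoot (exF d) ![a, b, 0] ![0, 0, 1] t ↔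
      t ^ d + a ^ (d - 1) * t + b ^ d = 0 ∧ d * t ^ (d - 1) + a ^ (d - 1) = 0 := by
    intro a b t
    rw [DoubleRoot, hl, derivative_add, derivative_add, derivative_X_pow, derivative_C_mul,
      derivative_X, derivative_C]
    simp
  rw [qpoly_ne_zero_iff hd hF]
  refine ⟨by simp, hFx, ?_, ?_⟩
  · rintro ⟨t, ht⟩
    rw [hdr, zero_pow hd3] at ht
    obtain ⟨h1, h2⟩ := ht
    simp [hd0, hd3] at h2
    simp [h2, hd2] at h1
  · obtain ⟨S, hS, hSr⟩ := example_set hd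
    apply roots_count_conv (discB_natDegree_le _ _ _) _ S hS.ge
    · intro b hb
      rw [discB_root_iff hF hFx]
      obtain ⟨t, ht⟩ := hSr b hb
      exact ⟨t, by rw [hdr]; simpa using ht⟩
    · intro h0
      have h : (discB d (coeffs1 (exF d)) ![0, 0, 1]).eval 0 = 0 := by rw [h0]; simp
      rw [discB_root_iff hF hFx] at h
      obtain ⟨t, ht⟩ := h
      rw [hdr, zero_pow hd2, one_pow] at ht
      obtain ⟨h1, h2⟩ := ht
      have h3 : t ^ d = t ^ (d - 1) * t := by rw [← pow_succ]; congr 1; omega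
      have h4 : t * (1 - d) = 0 := by
        linear_combination (-(d : ℂ)) * h1 + (d : ℂ) * h3 + t * h2
      have hd1 : (1 : ℂ) - d ≠ 0 := by
        rw [sub_ne_zero]; exact_mod_cast (by omega : 1 ≠ d)
      have h5 := (mul_eq_zero.1 h4).resolve_right hd1
      simp [h5, hd3] at h2

/-- For a general plane curve of degree `d` and a general point `[x] ∈ ℙ²`, the number
of lines through `[x]` tangent to the curve is exactly `d(d − 1)` (the degree of the
dual curve). -/
theorem tangent_lines_through_general_point_count (d : ℕ) (hd : 2 ≤ d) :
    ∃ Q : MvPolynomial ((Fin 3 →₀ ℕ) ⊕ Fin 3) ℂ,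
      (∃ (F : MvPolynomial (Fin 3) ℂ) (x : Fin 3 → ℂ),
          F.IsHomogeneous d ∧ F ≠ 0 ∧ x ≠ 0 ∧
          MvPolynomial.eval (Sum.elim (coeffs1 F) x) Q ≠ 0) ∧
      ∀ (F : MvPolynomial (Fin 3) ℂ) (x : Fin 3 → ℂ),
        F.IsHomogeneous d → F ≠ 0 → x ≠ 0 →
        MvPolynomial.eval (Sum.elim (coeffs1 F) x) Q ≠ 0 →
          (tangentLinesThrough F x).Finite ∧
            ((tangentLinesThrough F x).ncard : ℤ) = (d : ℤ) * ((d : ℤ) - 1) := by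

  have hev : ∀ (F : MvPolynomial (Fin 3) ℂ) (x : Fin 3 → ℂ),
      MvPolynomial.eval (Sum.elim (coeffs1 F) x)
        (qpoly d (MvPolynomial.X ∘ Sum.inl) (MvPolynomial.X ∘ Sum.inr)) =
      qpoly d (coeffs1 F) x := by
    intro F x
    rw [qpoly_map]
    congr 1
    · funext m; simp
    · funext m; simp
  refine ⟨qpoly d (MvPolynomial.X ∘ Sum.inl) (MvPolynomial.X ∘ Sum.inr),
    ⟨exF d, ![0, 0, 1], exF_homog hd, ?_, ?_, ?_⟩, ?_⟩
  · intro h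
    have := ((qpoly_ne_zero_iff hd (exF_homog hd) _).1 (example_ok hd)).2.1
    rw [h] at this
    simp at this
  · intro h
    have := congrFun h 2
    simp at this
  · rw [hev]
    exact example_ok hd
  · intro F x hF _ _ hQ
    rw [hev, qpoly_ne_zero_iff hd hF] at hQ
    obtain ⟨hx, hFx, hinf, hc, hr⟩ := hQ
    have himg := tangent_eq_image hF (by omega) hx hFx hinf
    have hset : {b | ∃ t, DoubleRoot F ![1, b, 0] x t} =
        ((discB d (coeffs1 F) x).roots.toFinset : Set ℂ) := by
      ext b
      have h0 : discB d (coeffs1 F) x ≠ 0 := by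
        intro h; rw [h] at hc; simp at hc
      rw [Set.mem_ofPred_eq, ← discB_root_iff hF hFx]
      simp [h0]
    rw [himg, hset]
    refine ⟨(Finset.finite_toSet _).image _, ?_⟩
    rw [Set.ncard_image_of_injective _ (line_injective hx), Set.ncard_coe_finset,
      roots_count (discB_natDegree_le _ _ _) hc hr]
    rw [Nat.cast_mul, Nat.cast_sub (by omega)]
    simp
end
end
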